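/- arXiv:0909.4801 — 2 statements merged into one kernel-verified Lean document; each statement's English description precedes it below -/
import Mathlib

section
/- Let (a₀, a₁, m) be three independent uniformly random bits, and let Z be a box with binary input t and output z_out = a_t ⊕ m (the state after Bob receives Alice's message in the information causality game, P(a₀ a₁ m z_out | z_in) = 1/8 if z_out = a_{z_in} ⊕ m, else 0). Define the entropies as minima of outcome Shannon entropy over fine-grained adaptive strategies: Ĥ(A₀) = H(a₀) = 1; Ĥ(MZ) = min over f : {0,1} → {0,1} of H(m, a_{f(m)} ⊕ m); Ĥ(A₀MZ) = min over f : {0,1}² → {0,1} of H(a₀, m, a_{f(a₀,m)} ⊕ m); Ĥ(A₁MZ) = min over f : {0,1}² → {0,1} of H(a₁, m, a_{f(a₁,m)} ⊕ m); Ĥ(A₀A₁MZ) = min over f : {0,1}³ → {0,1} of H(a₀, a₁, m, a_{f(a₀,a₁,m)} ⊕ m). Then Ĥ(MZ) = 2, Ĥ(A₀MZ) = 2, Ĥ(A₁MZ) = 2, Ĥ(A₀A₁MZ) = 3, and consequently, with mutual information Î(A;B) := Ĥ(A) + Ĥ(B) − Ĥ(AB), one has Î(A₀; A₁MZ) = 0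 while Î(A₀; MZ) = 1. Hence the data processing inequality Î(A₀; A₁MZ) ≥ Î(A₀; MZ) fails in box world. -/
open scoped BigOperators

/-- Shannon entropy (base 2) of a probability vector, with the convention `0 * log 0 = 0`. -/
noncomputable def shannonH {α : Type*} [Fintype α] (q : α → ℝ) : ℝ :=
  -∑ a, q a * Real.logb 2 (q a)

/-- `sel t a₀ a₁ = a_t`. -/
def sel (t a₀ a₁ : Bool) : Bool := bif t then a₁ else a₀

/-- Distribution of `(m, a_{f(m)} ⊕ m)`, with `(a₀,a₁,m)` uniform on `{0,1}³`. -/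
noncomputable def distMZ (f : Bool → Bool) : Bool × Bool → ℝ :=
  fun o => ∑ a₀ : Bool, ∑ a₁ : Bool,
    if o.2 = xor (sel (f o.1) a₀ a₁) o.1 then 1 / 8 else 0

/-- Distribution of `(a₀, m, a_{f(a₀,m)} ⊕ m)`. -/
noncomputable def distA0MZ (f : Bool → Bool → Bool) : Bool × Bool × Bool → ℝ :=
  fun o => ∑ a₁ : Bool,
    if o.2.2 = xor (sel (f o.1 o.2.1) o.1 a₁) o.2.1 then 1 / 8 else 0

/-- Distribution of `(a₁, m, a_{f(a₁,m)} ⊕ m)`. -/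
noncomputable def distA1MZ (f : Bool → Bool → Bool) : Bool × Bool × Bool → ℝ :=
  fun o => ∑ a₀ : Bool,
    if o.2.2 = xor (sel (f o.1 o.2.1) a₀ o.1) o.2.1 then 1 / 8 else 0

/-- Distribution of `(a₀, a₁, m, a_{f(a₀,a₁,m)} ⊕ m)`. -/
noncomputable def distA0A1MZ (f : Bool → Bool → Bool → Bool) :
    Bool × Bool × Bool × Bool → ℝ :=
  fun o => if o.2.2.2 = xor (sel (f o.1 o.2.1 o.2.2.1) o.1 o.2.1) o.2.2.1 then 1 / 8 else 0

noncomputable def hatH_A0 : ℝ := shannonH (fun _ : Bool => (1 / 2 : ℝ))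

noncomputable def hatH_MZ : ℝ :=
  sInf { h : ℝ | ∃ f : Bool → Bool, h = shannonH (distMZ f) }

noncomputable def hatH_A0MZ : ℝ :=
  sInf { h : ℝ | ∃ f : Bool → Bool → Bool, h = shannonH (distA0MZ f) }

noncomputable def hatH_A1MZ : ℝ :=
  sInf { h : ℝ | ∃ f : Bool → Bool → Bool, h = shannonH (distA1MZ f) }

noncomputable def hatH_A0A1MZ : ℝ :=
  sInf { h : ℝ | ∃ f : Bool → Bool → Bool → Bool, h = shannonH (distA0A1MZ f) }

theorem le_shannonH_of_le_two_rpow_neg {α : Type*} [Fintype α] {q : α → ℝ} {k : ℝ}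
    (h0 : ∀ a, 0 ≤ q a) (hk : ∀ a, q a ≤ 2 ^ (-k)) (hsum : ∑ a, q a = 1) :
    k ≤ shannonH q := by
  have key : ∀ a, q a * Real.logb 2 (q a) ≤ q a * (-k) := fun a ↦ by
    rcases (h0 a).eq_or_lt with h | h
    · simp [← h]
    · exact mul_le_mul_of_nonneg_left
        ((Real.logb_le_iff_le_rpow one_lt_two h).2 (hk a)) (h0 a)
  have h := Finset.sum_le_sum fun a (_ : a ∈ Finset.univ) ↦ key a
  rw [← Finset.sum_mul, hsum] at h
  unfold shannonH
  linarith

theorem shannonH_eq_of_eq_zero_or_two_rpow_neg {α : Type*} [Fintype α] {q : α → ℝ} {k : ℝ}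
    (hq : ∀ a, q a = 0 ∨ q a = 2 ^ (-k)) (hsum : ∑ a, q a = 1) :
    shannonH q = k := by
  have key : ∀ a, q a * Real.logb 2 (q a) = q a * (-k) := fun a ↦ by
    rcases hq a with h | h
    · simp [h]
    · rw [h, Real.logb_rpow two_pos one_lt_two.ne']
  rw [shannonH, Finset.sum_congr rfl fun a _ ↦ key a, ← Finset.sum_mul, hsum]
  ring

theorem two_rpow_neg_two : (2 : ℝ) ^ (-2 : ℝ) = 1 / 4 := by
  rw [Real.rpow_neg two_pos.le, Real.rpow_two]
  norm_num

theorem two_rpow_neg_three : (2 : ℝ) ^ (-3 : ℝ) = 1 / 8 := by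
  rw [Real.rpow_neg two_pos.le, show (3 : ℝ) = (3 : ℕ) by norm_num, Real.rpow_natCast]
  norm_num

theorem hatH_A0_eq_one : hatH_A0 = 1 :=
  shannonH_eq_of_eq_zero_or_two_rpow_neg
    (fun _ ↦ Or.inr (by rw [Real.rpow_neg_one]; norm_num)) (by simp)

theorem shannonH_distMZ (f : Bool → Bool) : shannonH (distMZ f) = 2 := by
  apply shannonH_eq_of_eq_zero_or_two_rpow_neg
  · rintro ⟨m, z⟩
    right
    cases hf : f m <;> cases m <;> cases z <;>
      norm_num [distMZ, sel, two_rpow_neg_two, hf]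
  · cases hf : f false <;> cases ht : f true <;>
      norm_num [distMZ, sel, Fintype.sum_prod_type, hf, ht]

theorem isLeast_shannonH_distMZ :
    IsLeast { h : ℝ | ∃ f : Bool → Bool, h = shannonH (distMZ f) } 2 :=
  ⟨⟨id, (shannonH_distMZ id).symm⟩, by rintro _ ⟨f, rfl⟩; exact (shannonH_distMZ f).ge⟩

theorem sum_distA0MZ (f : Bool → Bool → Bool) : ∑ o, distA0MZ f o = 1 := by
  have h : ∀ a m, ∑ z, distA0MZ f (a, m, z) = 1 / 4 := fun a m ↦ by
    cases hf : f a m <;> cases a <;> cases m <;> norm_num [distA0MZ, sel, hf]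
  simp only [Fintype.sum_prod_type, h]
  norm_num

theorem isLeast_shannonH_distA0MZ :
    IsLeast { h : ℝ | ∃ f : Bool → Bool → Bool, h = shannonH (distA0MZ f) } 2 := by
  refine ⟨⟨fun _ _ ↦ false,
    (shannonH_eq_of_eq_zero_or_two_rpow_neg ?_ (sum_distA0MZ _)).symm⟩, ?_⟩
  · rintro ⟨a, m, z⟩
    cases a <;> cases m <;> cases z <;> norm_num [distA0MZ, sel, two_rpow_neg_two]
  · rintro _ ⟨f, rfl⟩
    refine le_shannonH_of_le_two_rpow_neg ?_ ?_ (sum_distA0MZ f)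
    · exact fun o ↦ Finset.sum_nonneg fun _ _ ↦ by split_ifs <;> norm_num
    · rintro ⟨a, m, z⟩
      cases hf : f a m <;> cases a <;> cases m <;> cases z <;>
        norm_num [distA0MZ, sel, two_rpow_neg_two, hf]

theorem sum_distA1MZ (f : Bool → Bool → Bool) : ∑ o, distA1MZ f o = 1 := by
  have h : ∀ a m, ∑ z, distA1MZ f (a, m, z) = 1 / 4 := fun a m ↦ by
    cases hf : f a m <;> cases a <;> cases m <;> norm_num [distA1MZ, sel, hf]
  simp only [Fintype.sum_prod_type, h]
  norm_num

theorem isLeast_shannonH_distA1MZ :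
    IsLeast { h : ℝ | ∃ f : Bool → Bool → Bool, h = shannonH (distA1MZ f) } 2 := by
  refine ⟨⟨fun _ _ ↦ true,
    (shannonH_eq_of_eq_zero_or_two_rpow_neg ?_ (sum_distA1MZ _)).symm⟩, ?_⟩
  · rintro ⟨a, m, z⟩
    cases a <;> cases m <;> cases z <;> norm_num [distA1MZ, sel, two_rpow_neg_two]
  · rintro _ ⟨f, rfl⟩
    refine le_shannonH_of_le_two_rpow_neg ?_ ?_ (sum_distA1MZ f)
    · exact fun o ↦ Finset.sum_nonneg fun _ _ ↦ by split_ifs <;> norm_num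
    · rintro ⟨a, m, z⟩
      cases hf : f a m <;> cases a <;> cases m <;> cases z <;>
        norm_num [distA1MZ, sel, two_rpow_neg_two, hf]

theorem shannonH_distA0A1MZ (f : Bool → Bool → Bool → Bool) :
    shannonH (distA0A1MZ f) = 3 := by
  apply shannonH_eq_of_eq_zero_or_two_rpow_neg
  · intro o
    rw [two_rpow_neg_three, distA0A1MZ]
    split_ifs <;> simp
  · simp only [distA0A1MZ, Fintype.sum_prod_type, Finset.sum_ite_eq', Finset.mem_univ, if_true]
    norm_num

theorem isLeast_shannonH_distA0A1MZ :
    IsLeast { h : ℝ | ∃ f : Bool → Bool → Bool → Bool, h = shannonH (distA0A1MZ f) } 3 :=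
  ⟨⟨fun _ _ _ ↦ false, (shannonH_distA0A1MZ _).symm⟩, by
    rintro _ ⟨f, rfl⟩; exact (shannonH_distA0A1MZ f).ge⟩

/-- in the information-causality state of box world,
`Ĥ(A₀) = 1`, `Ĥ(MZ) = 2`, `Ĥ(A₀MZ) = 2`, `Ĥ(A₁MZ) = 2`, `Ĥ(A₀A₁MZ) = 3`
(each `Ĥ` a minimum over adaptive fine-grained strategies, here attained), so with
`Î(A;B) := Ĥ(A) + Ĥ(B) − Ĥ(AB)` one gets `Î(A₀; A₁MZ) = 0` while `Î(A₀; MZ) = 1`;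
the data processing inequality `Î(A₀; A₁MZ) ≥ Î(A₀; MZ)` fails. -/
theorem boxWorld_data_processing_violation :
    hatH_A0 = 1 ∧
    IsLeast { h : ℝ | ∃ f : Bool → Bool, h = shannonH (distMZ f) } 2 ∧
    IsLeast { h : ℝ | ∃ f : Bool → Bool → Bool, h = shannonH (distA0MZ f) } 2 ∧
    IsLeast { h : ℝ | ∃ f : Bool → Bool → Bool, h = shannonH (distA1MZ f) } 2 ∧
    IsLeast { h : ℝ | ∃ f : Bool → Bool → Bool → Bool, h = shannonH (distA0A1MZ f) } 3 ∧
    hatH_A0 + hatH_A1MZ - hatH_A0A1MZ = 0 ∧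
    hatH_A0 + hatH_MZ - hatH_A0MZ = 1 ∧
    hatH_A0 + hatH_A1MZ - hatH_A0A1MZ < hatH_A0 + hatH_MZ - hatH_A0MZ := by
  have hMZ : hatH_MZ = 2 := isLeast_shannonH_distMZ.csInf_eq
  have hA0MZ : hatH_A0MZ = 2 := isLeast_shannonH_distA0MZ.csInf_eq
  have hA1MZ : hatH_A1MZ = 2 := isLeast_shannonH_distA1MZ.csInf_eq
  have hA0A1MZ : hatH_A0A1MZ = 3 := isLeast_shannonH_distA0A1MZ.csInf_eq
  refine ⟨hatH_A0_eq_one, isLeast_shannonH_distMZ, isLeast_shannonH_distA0MZ,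
    isLeast_shannonH_distA1MZ, isLeast_shannonH_distA0A1MZ, ?_, ?_, ?_⟩ <;>
  norm_num [hatH_A0_eq_one, hMZ, hA0MZ, hA1MZ, hA0A1MZ]
end

section
/- Let (a₀, a₁, m) be three independent uniformly random bits, and let Z be a box with binary input t and output z_out = a_t ⊕ m. With Ĥ defined as the minimum outcome Shannon entropy over fine-grained adaptive strategies, one has Ĥ(A₀A₁) = 2, Ĥ(MZ) = 2, and Ĥ(A₀A₁MZ) = 3, and therefore the mutual information Î(A₀A₁; MZ) := Ĥ(A₀A₁) + Ĥ(MZ) − Ĥ(A₀A₁MZ) = 1 ≤ 1. Thus in the box-world information causality protocol, the total mutual information that Bob's systems (the one-bit message M together with his part Z of the PR-box) hold about Alice's two-bit string A₀A₁ is exactly one bit. -/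
open scoped BigOperators

/-- `Ĥ(A₀A₁)`: the two bits are uniform on `{0,1}²`. -/
noncomputable def hatH_A0A1 : ℝ := shannonH (fun _ : Bool × Bool => (1 / 4 : ℝ))

theorem logb_two_one_div_two_pow (n : ℕ) : Real.logb 2 (1 / 2 ^ n) = -n := by
  rw [one_div, Real.logb_inv, Real.logb_pow, Real.logb_self_eq_one one_lt_two, mul_one]

theorem shannonH_quarter : shannonH (fun _ : Bool × Bool => (1 / 4 : ℝ)) = 2 := by
  have h : Real.logb 2 (1 / 4) = -2 := by
    convert logb_two_one_div_two_pow 2 using 2 <;> norm_num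
  simp only [shannonH, h, Finset.sum_const, Finset.card_univ, Fintype.card_prod,
    Fintype.card_bool, nsmul_eq_mul]
  norm_num

/-- Bob's outcomes are uniform on `{0,1}²`, whatever his strategy. -/
theorem distMZ_eq_quarter (f : Bool → Bool) : distMZ f = fun _ => 1 / 4 := by
  funext ⟨m, z⟩
  rcases h : f m <;> cases m <;> cases z <;>
    simp [distMZ, sel, h] <;> norm_num

/-- in the box-world information-causality protocol,
`Ĥ(A₀A₁) = 2`, `Ĥ(MZ) = 2`, `Ĥ(A₀A₁MZ) = 3`, and hence the mutual information
`Î(A₀A₁; MZ) = Ĥ(A₀A₁) + Ĥ(MZ) − Ĥ(A₀A₁MZ) = 1 ≤ 1`: Bob's systems hold exactly one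
bit of information about Alice's two-bit string. -/
theorem boxWorld_information_causality_one_bit :
    hatH_A0A1 = 2 ∧
    IsLeast { h : ℝ | ∃ f : Bool → Bool, h = shannonH (distMZ f) } 2 ∧
    IsLeast { h : ℝ | ∃ f : Bool → Bool → Bool → Bool, h = shannonH (distA0A1MZ f) } 3 ∧
    hatH_A0A1 + hatH_MZ - hatH_A0A1MZ = 1 ∧
    hatH_A0A1 + hatH_MZ - hatH_A0A1MZ ≤ 1 := by
  have information : hatH_A0A1 + hatH_MZ - hatH_A0A1MZ = 1 := by
    rw [hatH_A0A1, hatH_MZ, hatH_A0A1MZ, shannonH_quarter,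
      isLeast_shannonH_distMZ.csInf_eq, isLeast_shannonH_distA0A1MZ.csInf_eq]
    norm_num
  exact ⟨shannonH_quarter, isLeast_shannonH_distMZ, isLeast_shannonH_distA0A1MZ,
    information, information.le⟩
end
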